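/- Let G : ℝ^d → ℝ be a smooth function such that for every multi-index α with |α| ≤ d₀ there is C_α with |∂^α(G(x) - 1)| ≤ C_α ⟨x⟩^{-ρ₀-|α|}, where 0 < ρ₀ ≤ 1 and ⟨x⟩ = (1+|x|²)^{1/2}. Fix ρ̄ ∈ (0, ρ₀). Then for every γ > 0 there exist G₀ ∈ C_c^∞(ℝ^d) and a smooth G_∞ with G = G₀ + G_∞ and sup_{|α| ≤ d₀} sup_{x} ⟨x⟩^{ρ̄+|α|} |∂^α(G_∞(x) - 1)| ≤ γ. -/

import Mathlib

open Filter Topology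

theorem aux_cutoff {E : Type*} [NormedAddCommGroup E] [InnerProductSpace ℝ E]
    (φ : E → ℝ) (hφ : ContDiff ℝ (⊤ : ℕ∞) φ) (hc : HasCompactSupport φ) (k : ℕ) :
    ∃ M : ℝ, 0 ≤ M ∧ ∀ R : ℝ, 1 ≤ R → ∀ x,
      ‖iteratedFDeriv ℝ k (fun y => φ (R⁻¹ • y)) x‖ ≤ M * (1 + ‖x‖ ^ 2) ^ (-((k : ℝ) / 2)) := by
  have hcont : Continuous (iteratedFDeriv ℝ k φ) :=
    hφ.continuous_iteratedFDeriv (by exact_mod_cast le_top)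
  have hpc : Continuous (fun y : E => (1 + ‖y‖ ^ 2) ^ ((k : ℝ) / 2)) := by
    apply Continuous.rpow_const (by fun_prop)
    intro x; left; positivity
  obtain ⟨M, hM⟩ := (hpc.smul hcont).bounded_above_of_compact_support
    ((hc.iteratedFDeriv (𝕜 := ℝ) k).smul_left)
  refine ⟨M, (norm_nonneg _).trans (hM 0), fun R hR x => ?_⟩
  have hR0 : 0 < R := by linarith
  have h1 := congrFun (iteratedFDeriv_comp_const_smul (i := k) (f := φ) R⁻¹
    (hφ.of_le (by exact_mod_cast le_top))) x
  rw [h1, norm_smul, norm_pow, norm_inv, Real.norm_of_nonneg hR0.le]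
  have h2 := hM (R⁻¹ • x)
  have hS : 0 < 1 + ‖x‖ ^ 2 := by positivity
  have hT : 0 < 1 + ‖R⁻¹ • x‖ ^ 2 := by positivity
  rw [Pi.smul_apply', norm_smul, Real.norm_of_nonneg (by positivity)] at h2
  have h3 : (1 + ‖x‖ ^ 2) ^ ((k : ℝ) / 2) ≤ R ^ k * (1 + ‖R⁻¹ • x‖ ^ 2) ^ ((k : ℝ) / 2) := by
    have e : R ^ k = (R ^ 2) ^ ((k : ℝ) / 2) := by
      rw [← Real.rpow_natCast R 2, ← Real.rpow_mul hR0.le, ← Real.rpow_natCast]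
      congr 1; push_cast; ring
    rw [e, ← Real.mul_rpow (by positivity) hT.le]
    apply Real.rpow_le_rpow hS.le _ (by positivity)
    rw [norm_smul, norm_inv, Real.norm_of_nonneg hR0.le]
    have : R ^ 2 * (1 + (R⁻¹ * ‖x‖) ^ 2) = R ^ 2 + ‖x‖ ^ 2 := by field_simp
    rw [this]; nlinarith
  rw [Real.rpow_neg hS.le, ← div_eq_mul_inv, le_div_iff₀ (by positivity)]
  have hRk : 0 < R ^ k := by positivity
  calc _ ≤ R⁻¹ ^ k * ‖iteratedFDeriv ℝ k φ (R⁻¹ • x)‖ *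
        (R ^ k * (1 + ‖R⁻¹ • x‖ ^ 2) ^ ((k : ℝ) / 2)) := by gcongr
    _ = (1 + ‖R⁻¹ • x‖ ^ 2) ^ ((k : ℝ) / 2) * ‖iteratedFDeriv ℝ k φ (R⁻¹ • x)‖ := by
        rw [inv_pow]; field_simp
    _ ≤ M := h2

/-- scalar version of Lemma 3.6. A long-range perturbation `G` of the
constant `1` (symbol class `𝒮^{-ρ₀}` up to order `d₀`) splits, for any `γ > 0`, as
`G = G₀ + G_∞` with `G₀ ∈ C_c^∞` and `‖G_∞ - 1‖_{𝒮^{-ρ̄}} ≤ γ`, for any `ρ̄ ∈ (0, ρ₀)`. -/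
theorem stmt_16 {d : ℕ} (d₀ : ℕ) (ρ₀ ρb : ℝ) (h₀ : 0 < ρ₀) (h₀' : ρ₀ ≤ 1)
    (hρb : ρb ∈ Set.Ioo (0 : ℝ) ρ₀)
    (G : EuclideanSpace ℝ (Fin d) → ℝ) (hG : ContDiff ℝ (⊤ : ℕ∞) G)
    (hdec : ∀ n : ℕ, n ≤ d₀ → ∃ Cn : ℝ, ∀ x,
      ‖iteratedFDeriv ℝ n (fun y => G y - 1) x‖ ≤
        Cn * (1 + ‖x‖ ^ 2) ^ (-((ρ₀ + n) / 2)))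
    (γ : ℝ) (hγ : 0 < γ) :
    ∃ G₀ Gi : EuclideanSpace ℝ (Fin d) → ℝ,
      ContDiff ℝ (⊤ : ℕ∞) G₀ ∧ HasCompactSupport G₀ ∧ ContDiff ℝ (⊤ : ℕ∞) Gi ∧
      (∀ x, G x = G₀ x + Gi x) ∧
      ∀ n : ℕ, n ≤ d₀ → ∀ x,
        (1 + ‖x‖ ^ 2) ^ ((ρb + n) / 2) *
          ‖iteratedFDeriv ℝ n (fun y => Gi y - 1) x‖ ≤ γ := by
  classical
  obtain ⟨hb0, hb1⟩ := hρb
  let φ : ContDiffBump (0 : EuclideanSpace ℝ (Fin d)) := ⟨1, 2, one_pos, one_lt_two⟩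
  have hφ : ContDiff ℝ (⊤ : ℕ∞) (φ : EuclideanSpace ℝ (Fin d) → ℝ) := φ.contDiff
  choose M hM0 hM using aux_cutoff φ hφ φ.hasCompactSupport
  have hdec' : ∀ n : ℕ, ∃ Cn : ℝ, 0 ≤ Cn ∧ (n ≤ d₀ → ∀ x,
      ‖iteratedFDeriv ℝ n (fun y => G y - 1) x‖ ≤
        Cn * (1 + ‖x‖ ^ 2) ^ (-((ρ₀ + n) / 2))) := by
    intro n
    by_cases hn : n ≤ d₀
    · obtain ⟨C, hC⟩ := hdec n hn
      refine ⟨|C|, abs_nonneg _, fun _ x => (hC x).trans ?_⟩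
      gcongr
      exact le_abs_self C
    · exact ⟨0, le_rfl, fun h => absurd h hn⟩
  choose C hC0 hC using hdec'
  let K : ℕ → ℝ := fun n => C n + ∑ i ∈ Finset.range (n + 1), (n.choose i : ℝ) * C i * M (n - i)
  have hK0 : ∀ n, 0 ≤ K n := fun n => by
    have := hC0 n
    have : 0 ≤ ∑ i ∈ Finset.range (n + 1), (n.choose i : ℝ) * C i * M (n - i) :=
      Finset.sum_nonneg fun i _ => mul_nonneg (mul_nonneg (by positivity) (hC0 i)) (hM0 _)
    positivity
  let Kt : ℝ := ∑ n ∈ Finset.range (d₀ + 1), K n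
  have hKt : ∀ n ≤ d₀, K n ≤ Kt := fun n hn =>
    Finset.single_le_sum (f := K) (fun i _ => hK0 i) (Finset.mem_range.2 (by omega))
  have hKt0 : 0 ≤ Kt := Finset.sum_nonneg fun i _ => hK0 i
  have hlim : Tendsto (fun R : ℝ => Kt * (1 + R ^ 2) ^ (-((ρ₀ - ρb) / 2))) atTop (𝓝 0) := by
    have h1 : Tendsto (fun R : ℝ => 1 + R ^ 2) atTop atTop :=
      tendsto_atTop_add_const_left _ _ (tendsto_pow_atTop two_ne_zero)
    have h2 := (tendsto_rpow_neg_atTop (y := (ρ₀ - ρb) / 2) (by linarith)).comp h1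
    simpa using h2.const_mul Kt
  obtain ⟨R, hRγ, hR⟩ := ((hlim.eventually_le_const hγ).and (eventually_ge_atTop 1)).exists
  have hR0 : 0 < R := by linarith
  have hu : ContDiff ℝ (⊤ : ℕ∞) (fun y => G y - 1) := hG.sub contDiff_const
  have hψ : ContDiff ℝ (⊤ : ℕ∞) (fun y => φ (R⁻¹ • y)) := hφ.comp (contDiff_const_smul _)
  have hψc : HasCompactSupport (fun y => φ (R⁻¹ • y)) :=
    φ.hasCompactSupport.comp_smul (inv_ne_zero hR0.ne')
  have hprod := hu.mul hψ
  refine ⟨fun y => (G y - 1) * φ (R⁻¹ • y),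
    fun y => 1 + ((G y - 1) - (G y - 1) * φ (R⁻¹ • y)), hprod, hψc.mul_left,
    contDiff_const.add (hu.sub hprod), fun x => by ring, fun n hn x => ?_⟩
  have e0 : (fun y => 1 + ((G y - 1) - (G y - 1) * φ (R⁻¹ • y)) - 1) =
      (fun y => G y - 1) - fun y => (G y - 1) * φ (R⁻¹ • y) := by
    funext y; simp
  rw [e0]
  have hS : 0 < 1 + ‖x‖ ^ 2 := by positivity
  rcases lt_or_ge ‖x‖ R with hx | hx
  · have hev : ((fun y => G y - 1) - fun y => (G y - 1) * φ (R⁻¹ • y)) =ᶠ[𝓝 x]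
        fun _ => (0 : ℝ) := by
      filter_upwards [(isOpen_lt continuous_norm continuous_const).mem_nhds hx] with y hy
      have hy' : ‖y‖ < R := hy
      have : φ (R⁻¹ • y) = 1 := by
        apply φ.one_of_mem_closedBall
        rw [mem_closedBall_zero_iff, norm_smul, norm_inv, Real.norm_of_nonneg hR0.le]
        change R⁻¹ * ‖y‖ ≤ 1
        rw [inv_mul_le_iff₀ hR0]; linarith
      simp [this]
    rw [(hev.iteratedFDeriv ℝ n).eq_of_nhds]
    have : iteratedFDeriv ℝ n (fun _ : EuclideanSpace ℝ (Fin d) => (0 : ℝ)) x = 0 := by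
      exact congrFun iteratedFDeriv_zero_fun x
    rw [this]; simpa using hγ.le
  · have hle : ∀ m : ℕ, ((m : ℕ∞) : WithTop ℕ∞) ≤ ((⊤ : ℕ∞) : WithTop ℕ∞) := fun m => by
      exact_mod_cast le_top
    have hmain : ‖iteratedFDeriv ℝ n ((fun y => G y - 1) - fun y => (G y - 1) * φ (R⁻¹ • y)) x‖
        ≤ K n * (1 + ‖x‖ ^ 2) ^ (-((ρ₀ + n) / 2)) := by
      rw [iteratedFDeriv_sub_apply (hu.of_le (hle n)).contDiffAt (hprod.of_le (hle n)).contDiffAt]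
      refine (norm_sub_le _ _).trans ?_
      simp only [K, add_mul]
      refine add_le_add (hC n hn x) ?_
      refine (norm_iteratedFDeriv_mul_le hu hψ x (hle n)).trans ?_
      rw [Finset.sum_mul]
      refine Finset.sum_le_sum fun i hi => ?_
      have hin : i ≤ n := by simpa [Nat.lt_succ_iff] using hi
      have a := hC i (hin.trans hn) x
      have b := hM (n - i) R hR x
      calc _ ≤ (n.choose i : ℝ) * (C i * (1 + ‖x‖ ^ 2) ^ (-((ρ₀ + i) / 2))) *
            (M (n - i) * (1 + ‖x‖ ^ 2) ^ (-(((n - i : ℕ) : ℝ) / 2))) := by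
              have := hC0 i
              gcongr
        _ = (n.choose i : ℝ) * C i * M (n - i) * ((1 + ‖x‖ ^ 2) ^ (-((ρ₀ + i) / 2)) *
            (1 + ‖x‖ ^ 2) ^ (-(((n - i : ℕ) : ℝ) / 2))) := by ring
        _ = _ := by
            rw [← Real.rpow_add hS]
            congr 2
            push_cast [hin]; ring
    calc _ ≤ (1 + ‖x‖ ^ 2) ^ ((ρb + n) / 2) * (Kt * (1 + ‖x‖ ^ 2) ^ (-((ρ₀ + n) / 2))) := by
          gcongr
          refine hmain.trans ?_
          gcongr
          exact hKt n hn
      _ = Kt * ((1 + ‖x‖ ^ 2) ^ ((ρb + n) / 2) * (1 + ‖x‖ ^ 2) ^ (-((ρ₀ + n) / 2))) := by ring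
      _ = Kt * (1 + ‖x‖ ^ 2) ^ (-((ρ₀ - ρb) / 2)) := by
          rw [← Real.rpow_add hS]; congr 2; ring
      _ ≤ Kt * (1 + R ^ 2) ^ (-((ρ₀ - ρb) / 2)) := by
          refine mul_le_mul_of_nonneg_left ?_ hKt0
          refine Real.rpow_le_rpow_of_nonpos (by positivity) (by gcongr) (by linarith)
      _ ≤ γ := hRγ
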